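/- arXiv:2504.15836 — 3 statements merged into one kernel-verified Lean document; each statement's English description precedes it below -/
import Mathlib

section
/- (Hyperbolic annulus measure bound, Lemma 4.4(i)) There exists a constant C such that for all N ≥ 2, all K ≥ 1, all C₀ ∈ ℝ, and all a, b ∈ ℝ with |a| ≤ N and |b| ≤ N, mes( { (ξ,k) ∈ ℝ×ℤ : C₀ ≤ (ξ−a)² − (k−b)² ≤ C₀ + K, |ξ| + |k| ≤ N } ) ≤ C · K · log N. -/
open MeasureTheory Real Set
open scoped ENNReal

noncomputable section

/-- The product of Lebesgue measure on `ℝ` and counting measure on `ℤ`: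
`mes S = Σ_{k∈ℤ} λ({ξ : (ξ,k) ∈ S})`. -/
def mes (S : Set (ℝ × ℤ)) : ℝ≥0∞ :=
  ∑' k : ℤ, volume {ξ : ℝ | (ξ, k) ∈ S}

theorem sqrt_add_sub_sqrt_mul_max_le (c m K : ℝ) (hK : 1 ≤ K) :
    (√(c + m ^ 2 + K) - √(c + m ^ 2)) * max 1 |(|m| - √(-c))| ≤ K := by
  have hs0 := Real.sqrt_nonneg (c + m ^ 2)
  have ht0 := Real.sqrt_nonneg (c + m ^ 2 + K)
  have hR0 := Real.sqrt_nonneg (-c)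
  have hm0 := abs_nonneg m
  have hm2 := sq_abs m
  rcases lt_or_ge (c + m ^ 2 + K) 0 with h | h
  · rw [Real.sqrt_eq_zero_of_nonpos h.le, Real.sqrt_eq_zero_of_nonpos (by linarith)]
    linarith
  have ht2 := Real.sq_sqrt h
  have key : |(|m| - √(-c))| ^ 2 ≤ |c + m ^ 2| := by
    rw [sq_abs]
    rcases le_or_gt 0 c with hc | hc
    · rw [Real.sqrt_eq_zero_of_nonpos (by linarith : -c ≤ 0)]
      exact le_abs.2 (Or.inl (by nlinarith))
    · have hR2 := Real.sq_sqrt (by linarith : 0 ≤ -c)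
      rcases le_total |m| (√(-c)) with hh | hh
      · exact le_abs.2 (Or.inr (by nlinarith))
      · exact le_abs.2 (Or.inl (by nlinarith))
  set s := √(c + m ^ 2)
  set t := √(c + m ^ 2 + K)
  set d := |(|m| - √(-c))|
  have hd0 : 0 ≤ d := abs_nonneg _
  have hM0 : 0 ≤ max 1 d := le_max_of_le_right hd0
  rcases le_or_gt 0 (c + m ^ 2) with hA | hA
  · have hs2 : s ^ 2 = _ := Real.sq_sqrt hA
    rw [abs_of_nonneg hA] at key
    have hst : s ≤ t := Real.sqrt_le_sqrt (by linarith)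
    have hM : max 1 d ≤ t :=
      max_le (by nlinarith) (abs_le_of_sq_le_sq' (by linarith) ht0).2
    nlinarith [mul_le_mul_of_nonneg_left hM (sub_nonneg.2 hst),
      mul_nonneg hs0 (sub_nonneg.2 hst)]
  · have hs : s = 0 := Real.sqrt_eq_zero_of_nonpos hA.le
    rw [abs_of_neg hA] at key
    have hM : max 1 d ^ 2 ≤ K := by
      rcases max_choice 1 d with h' | h' <;> rw [h'] <;> linarith
    rw [hs]
    nlinarith [sq_nonneg (t - max 1 d)]

theorem volume_slice_le (a c m K : ℝ) (hK : 1 ≤ K) :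
    volume {ξ : ℝ | c ≤ (ξ - a) ^ 2 - m ^ 2 ∧ (ξ - a) ^ 2 - m ^ 2 ≤ c + K} ≤
      ENNReal.ofReal (2 * K / max 1 |(|m| - √(-c))|) := by
  set s := √(c + m ^ 2)
  set t := √(c + m ^ 2 + K)
  have hst : s ≤ t := Real.sqrt_le_sqrt (by linarith)
  have hsub : {ξ : ℝ | c ≤ (ξ - a) ^ 2 - m ^ 2 ∧ (ξ - a) ^ 2 - m ^ 2 ≤ c + K} ⊆
      Icc (a + s) (a + t) ∪ Icc (a - t) (a - s) := by
    rintro ξ ⟨h1, h2⟩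
    have h3 : s ≤ |ξ - a| := by
      rw [← Real.sqrt_sq_eq_abs]
      exact Real.sqrt_le_sqrt (by linarith)
    have h4 : |ξ - a| ≤ t := Real.abs_le_sqrt (by linarith)
    rcases abs_cases (ξ - a) with ⟨h, -⟩ | ⟨h, -⟩ <;> rw [h] at h3 h4
    · exact Or.inl ⟨by linarith, by linarith⟩
    · exact Or.inr ⟨by linarith, by linarith⟩
  refine (measure_mono hsub).trans ((measure_union_le _ _).trans ?_)
  rw [Real.volume_Icc, Real.volume_Icc, ← ENNReal.ofReal_add (by linarith) (by linarith)]
  refine ENNReal.ofReal_le_ofReal ?_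
  rw [le_div_iff₀ (lt_max_of_lt_left one_pos)]
  linarith [sqrt_add_sub_sqrt_mul_max_le c m K hK]

theorem one_div_max_one_abs_abs_sub_le (m R : ℝ) :
    1 / max 1 |(|m| - R)| ≤ 1 / max 1 |m - R| + 1 / max 1 |m - -R| := by
  rcases abs_cases m with ⟨h, -⟩ | ⟨h, -⟩ <;> rw [h]
  · exact le_add_of_nonneg_right (by positivity)
  · rw [show -m - R = -(m - -R) by ring, abs_neg]
    exact le_add_of_nonneg_left (by positivity)

theorem sum_Icc_neg_one_div_le (M : ℕ) :
    ∑ i ∈ Finset.Icc (-(M : ℤ)) M, 1 / (1 + |(i : ℝ)|) ≤ 2 * (1 + Real.log (M + 1)) := by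
  have hsub : Finset.Icc (-(M : ℤ)) M ⊆
      (Finset.range (M + 1)).image (fun i : ℕ => (i : ℤ)) ∪
        (Finset.range (M + 1)).image (fun i : ℕ => -(i : ℤ)) := by
    intro i hi
    simp only [Finset.mem_Icc, Finset.mem_union, Finset.mem_image, Finset.mem_range] at hi ⊢
    rcases le_total 0 i with h | h
    · exact Or.inl ⟨i.toNat, by omega, by omega⟩
    · exact Or.inr ⟨(-i).toNat, by omega, by omega⟩
  have hH : ∑ i ∈ Finset.range (M + 1), 1 / (1 + (i : ℝ)) ≤ 1 + Real.log (M + 1) := by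
    have := harmonic_le_one_add_log (M + 1)
    simp only [harmonic] at this
    push_cast at this
    simpa [add_comm] using this
  refine (Finset.sum_le_sum_of_subset_of_nonneg hsub fun _ _ _ => by positivity).trans ?_
  have hui := Finset.sum_union_inter
    (s₁ := (Finset.range (M + 1)).image (fun i : ℕ => (i : ℤ)))
    (s₂ := (Finset.range (M + 1)).image (fun i : ℕ => -(i : ℤ)))
    (f := fun i : ℤ => 1 / (1 + |(i : ℝ)|))
  rw [Finset.sum_image (by intro x _ y _ h; simpa using h),
    Finset.sum_image (by intro x _ y _ h; simpa using h)] at hui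
  simp only [Int.cast_neg, Int.cast_natCast, abs_neg, Nat.abs_cast] at hui
  have hnn : 0 ≤ ∑ i ∈ (Finset.range (M + 1)).image (fun i : ℕ => (i : ℤ)) ∩
      (Finset.range (M + 1)).image (fun i : ℕ => -(i : ℤ)), 1 / (1 + |(i : ℝ)|) :=
    Finset.sum_nonneg fun _ _ => by positivity
  linarith

theorem sum_Icc_one_div_max_one_abs_sub_le (n : ℕ) (x : ℝ) :
    ∑ k ∈ Finset.Icc (-(n : ℤ)) n, 1 / max 1 |(k : ℝ) - x| ≤
      6 * (1 + Real.log (2 * n + 1)) := by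
  set j : ℤ := max (-(n : ℤ)) (min n (round x)) with hj
  have hterm : ∀ k ∈ Finset.Icc (-(n : ℤ)) n,
      1 / max 1 |(k : ℝ) - x| ≤ 3 * (1 / (1 + |((k - j : ℤ) : ℝ)|)) := by
    intro k hk
    rw [Finset.mem_Icc] at hk
    have h1 : |k - j| ≤ |k - round x| := by
      have hj' : j = round x ∨ j = n ∧ n ≤ round x ∨ j = -n ∧ round x ≤ -n := by
        rcases max_cases (-(n : ℤ)) (min n (round x)) with h | h <;>
          rcases min_cases (n : ℤ) (round x) with h' | h' <;> grind
      clear_value j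
      grind
    have h1' : |((k - j : ℤ) : ℝ)| ≤ |(k : ℝ) - round x| := by exact_mod_cast h1
    have h2 : |(k : ℝ) - round x| ≤ |(k : ℝ) - x| + |x - round x| := abs_sub_le _ _ _
    have h3 := abs_sub_round x
    rw [mul_one_div, div_le_div_iff₀ (by positivity) (by positivity)]
    linarith [le_max_left 1 |(k : ℝ) - x|, le_max_right 1 |(k : ℝ) - x|]
  refine (Finset.sum_le_sum hterm).trans ?_
  rw [← Finset.mul_sum]
  have himg : ∑ k ∈ Finset.Icc (-(n : ℤ)) n, 1 / (1 + |((k - j : ℤ) : ℝ)|) =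
      ∑ i ∈ (Finset.Icc (-(n : ℤ)) n).image (fun k => k - j), 1 / (1 + |(i : ℝ)|) :=
    (Finset.sum_image (f := fun i : ℤ => 1 / (1 + |(i : ℝ)|))
      (sub_left_injective (b := j)).injOn).symm
  have hsub : (Finset.Icc (-(n : ℤ)) n).image (fun k => k - j) ⊆
      Finset.Icc (-((2 * n : ℕ) : ℤ)) (2 * n : ℕ) := by
    intro i hi
    simp only [Finset.mem_Icc, Finset.mem_image] at hi ⊢
    obtain ⟨k, hk, rfl⟩ := hi
    omega
  have h := Finset.sum_le_sum_of_subset_of_nonneg (f := fun i : ℤ => 1 / (1 + |(i : ℝ)|)) hsub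
    fun _ _ _ => by positivity
  have h' := sum_Icc_neg_one_div_le (2 * n)
  push_cast at h h' himg ⊢
  linarith

theorem one_add_log_two_mul_add_one_le {N y : ℝ} (hN : 2 ≤ N) (hy : 0 ≤ y) (hyN : y ≤ N) :
    1 + Real.log (2 * y + 1) ≤ 5 * Real.log N := by
  have h1 : Real.log (2 * y + 1) ≤ Real.log (N ^ 3) :=
    Real.log_le_log (by linarith)
      (by nlinarith [mul_self_nonneg (N - 2), pow_pos (by linarith : 0 < N) 2])
  rw [Real.log_pow] at h1
  have h2 : Real.log 2 ≤ Real.log N := Real.log_le_log two_pos hN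
  have := Real.log_two_gt_d9
  push_cast at h1
  linarith

/-- Lemma 4.4(i): hyperbolic annulus measure bound. -/
theorem hyperbolic_annulus_bound :
    ∃ C : ℝ, 0 < C ∧ ∀ N K C₀ a b : ℝ, 2 ≤ N → 1 ≤ K → |a| ≤ N → |b| ≤ N →
      mes {p : ℝ × ℤ | C₀ ≤ (p.1 - a) ^ 2 - ((p.2 : ℝ) - b) ^ 2 ∧
            (p.1 - a) ^ 2 - ((p.2 : ℝ) - b) ^ 2 ≤ C₀ + K ∧
            |p.1| + |(p.2 : ℝ)| ≤ N}
        ≤ ENNReal.ofReal (C * K * Real.log N) := by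
  refine ⟨120, by norm_num, fun N K C₀ a b hN hK _ _ => ?_⟩
  set n := ⌊N⌋₊
  have hn : (n : ℝ) ≤ N := Nat.floor_le (by linarith)
  set R := √(-C₀)
  unfold mes
  rw [tsum_eq_sum (s := Finset.Icc (-(n : ℤ)) n)]
  · calc _ ≤ ∑ k ∈ Finset.Icc (-(n : ℤ)) n,
          ENNReal.ofReal (2 * K / max 1 |(|(k : ℝ) - b| - R)|) :=
          Finset.sum_le_sum fun k _ => (measure_mono (t := {ξ : ℝ | C₀ ≤ (ξ - a) ^ 2 - ((k : ℝ) - b) ^ 2 ∧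
            (ξ - a) ^ 2 - ((k : ℝ) - b) ^ 2 ≤ C₀ + K}) fun ξ hξ => ⟨hξ.1, hξ.2.1⟩).trans
            (volume_slice_le a C₀ ((k : ℝ) - b) K hK)
      _ = ENNReal.ofReal (∑ k ∈ Finset.Icc (-(n : ℤ)) n,
          2 * K / max 1 |(|(k : ℝ) - b| - R)|) :=
          (ENNReal.ofReal_sum_of_nonneg fun _ _ => by positivity).symm
      _ ≤ _ := ENNReal.ofReal_le_ofReal ?_
    calc _ ≤ ∑ k ∈ Finset.Icc (-(n : ℤ)) n,
          2 * K * (1 / max 1 |(k : ℝ) - (b + R)| + 1 / max 1 |(k : ℝ) - (b - R)|) := by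
          refine Finset.sum_le_sum fun k _ => ?_
          have h := one_div_max_one_abs_abs_sub_le ((k : ℝ) - b) R
          rw [sub_sub, sub_sub, ← sub_eq_add_neg] at h
          rw [← mul_one_div]
          exact mul_le_mul_of_nonneg_left h (by linarith)
      _ ≤ 2 * K * (2 * (6 * (5 * Real.log N))) := by
          rw [← Finset.mul_sum, Finset.sum_add_distrib]
          refine mul_le_mul_of_nonneg_left ?_ (by linarith)
          linarith [sum_Icc_one_div_max_one_abs_sub_le n (b + R),
            sum_Icc_one_div_max_one_abs_sub_le n (b - R),
            one_add_log_two_mul_add_one_le hN n.cast_nonneg hn]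
      _ = _ := by ring
  · intro k hk
    convert measure_empty (μ := (volume : Measure ℝ))
    refine Set.eq_empty_of_forall_notMem fun ξ hξ => hk ?_
    have hkN : |(k : ℝ)| ≤ N := by linarith [hξ.2.2, abs_nonneg ξ]
    have hkn : k.natAbs ≤ n := Nat.le_floor (by rwa [Nat.cast_natAbs, Int.cast_abs])
    rw [Finset.mem_Icc]
    omega
end
end

section
/- (Key counting bound in the proof of Theorem 3.1) For every constant C₀ ≥ 1 there exists a constant C such that for all N ≥ 2, all τ ∈ ℝ, and all n ∈ ℤ, mes( B_N(τ,n) ) ≤ C · log N, where B_N(τ,n) = { (ξ₁,n₁) ∈ ℝ×ℤ : |τ + ξ₁² − (n−n₁)²| ≤ C₀, |n₁| ≤ 2N, |n−n₁| ≤ 2N }. -/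
open MeasureTheory Real Set
open scoped ENNReal

noncomputable section

/-- The set of `ξ` with `|ξ² - A| ≤ c` has measure at most `4c / √A` when `A > 0`. -/
lemma volume_abs_sq_sub_le {c A : ℝ} (hA : 0 < A) :
    volume {ξ : ℝ | |ξ ^ 2 - A| ≤ c} ≤ ENNReal.ofReal (4 * c / √A) := by
  have ha : 0 < √A := Real.sqrt_pos.2 hA
  have hsq : √A ^ 2 = A := Real.sq_sqrt hA.le
  rcases lt_or_ge c 0 with hc | hc
  · have : {ξ : ℝ | |ξ ^ 2 - A| ≤ c} = ∅ := by
      ext ξ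
      simpa using hc.trans_le (abs_nonneg (ξ ^ 2 - A))
    simp [this]
  have hsub : {ξ : ℝ | |ξ ^ 2 - A| ≤ c} ⊆
      Icc (√A - c / √A) (√A + c / √A) ∪ Icc (-√A - c / √A) (-√A + c / √A) := by
    intro ξ hξ
    have key : |ξ - √A| * |ξ + √A| ≤ c := by
      rw [← abs_mul, show (ξ - √A) * (ξ + √A) = ξ ^ 2 - A by linear_combination -hsq]
      exact hξ
    rcases le_total 0 ξ with h0 | h0
    · left
      have h1 : |ξ - √A| ≤ c / √A := by
        rw [le_div_iff₀ ha]
        refine le_trans ?_ key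
        gcongr
        exact (by linarith : √A ≤ ξ + √A).trans (le_abs_self _)
      have := abs_le.1 h1
      constructor <;> linarith
    · right
      have h1 : |ξ + √A| ≤ c / √A := by
        rw [le_div_iff₀ ha, mul_comm]
        refine le_trans ?_ key
        gcongr
        exact (by linarith : √A ≤ -(ξ - √A)).trans (neg_le_abs _)
      have := abs_le.1 h1
      constructor <;> linarith
  calc volume {ξ : ℝ | |ξ ^ 2 - A| ≤ c} ≤ _ := measure_mono hsub
    _ ≤ _ := measure_union_le _ _
    _ = ENNReal.ofReal (4 * c / √A) := by
      rw [Real.volume_Icc, Real.volume_Icc, ← ENNReal.ofReal_add]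
      · congr 1
        ring
      all_goals
        have : 0 ≤ c / √A := by positivity
        linarith

lemma volume_abs_sq_sub_le_four_mul {c A : ℝ} (hc : 1 ≤ c) (hA : A ≤ 1) :
    volume {ξ : ℝ | |ξ ^ 2 - A| ≤ c} ≤ ENNReal.ofReal (4 * c) := by
  have hsub : {ξ : ℝ | |ξ ^ 2 - A| ≤ c} ⊆ Icc (-(2 * c)) (2 * c) := by
    intro ξ hξ
    have h := (abs_le.1 hξ.out).2
    exact abs_le.1 (abs_le_of_sq_le_sq (by nlinarith) (by linarith))
  calc volume {ξ : ℝ | |ξ ^ 2 - A| ≤ c} ≤ _ := measure_mono hsub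
    _ = ENNReal.ofReal (4 * c) := by
      rw [Real.volume_Icc]
      congr 1
      ring

/-- The set of `ξ` with `|ξ² - A| ≤ c` has measure `O(1 / (1 + d))` as soon as `d² ≤ |A|`. -/
lemma volume_abs_sq_sub_le_div {c A d : ℝ} (hc : 1 ≤ c) (hd : 0 ≤ d) (hdA : d ^ 2 ≤ |A|) :
    volume {ξ : ℝ | |ξ ^ 2 - A| ≤ c} ≤ ENNReal.ofReal (8 * c ^ 2 / (1 + d)) := by
  rcases le_or_gt A 1 with h1 | h1
  · rcases lt_or_ge A (-c) with h2 | h2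
    · have : {ξ : ℝ | |ξ ^ 2 - A| ≤ c} = ∅ := by
        ext ξ
        simp only [mem_ofPred_eq, mem_empty_iff_false, iff_false, not_le]
        exact lt_of_lt_of_le (by nlinarith [sq_nonneg ξ]) (le_abs_self _)
      simp [this]
    · refine (volume_abs_sq_sub_le_four_mul hc h1).trans (ENNReal.ofReal_le_ofReal ?_)
      have hAc : |A| ≤ c := abs_le.2 ⟨h2, h1.trans hc⟩
      have hdc : d ≤ c := by nlinarith
      rw [le_div_iff₀ (by linarith)]
      nlinarith
  · refine (volume_abs_sq_sub_le (by linarith)).trans (ENNReal.ofReal_le_ofReal ?_)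
    rw [abs_of_pos (by linarith)] at hdA
    have hd' : d ≤ √A := Real.le_sqrt_of_sq_le hdA
    have h1' : 1 ≤ √A := Real.le_sqrt_of_sq_le (by linarith)
    rw [div_le_div_iff₀ (by linarith) (by linarith)]
    have : 4 * c * (1 + d) ≤ 4 * c * (2 * √A) := by gcongr; linarith
    nlinarith [mul_nonneg (by nlinarith : 0 ≤ c ^ 2 - c) (by linarith : 0 ≤ √A)]

lemma sq_abs_sub_sqrt_le (x τ : ℝ) : (|x| - √τ) ^ 2 ≤ |x ^ 2 - τ| := by
  rcases le_total 0 τ with h | h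
  · have hs := Real.sq_sqrt h
    have hn := Real.sqrt_nonneg τ
    have hx := abs_nonneg x
    have hx2 := sq_abs x
    rcases le_total (√τ) |x| with h' | h'
    · exact le_trans (by nlinarith) (le_abs_self _)
    · exact le_trans (by nlinarith) (neg_le_abs _)
  · rw [Real.sqrt_eq_zero_of_nonpos h, sub_zero, sq_abs]
    exact le_trans (by linarith) (le_abs_self _)

lemma sum_Icc_inv_one_add_natAbs_sub_le {M : ℕ} {j : ℤ} (hj : j ∈ Finset.Icc (-(M : ℤ)) M) :
    ∑ m ∈ Finset.Icc (-(M : ℤ)) M, (1 + ((m - j).natAbs : ℝ))⁻¹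
      ≤ 2 * (1 + Real.log ((2 * M + 1 : ℕ) : ℝ)) := by
  rw [Finset.mem_Icc] at hj
  rw [← Finset.sum_fiberwise_of_maps_to (t := Finset.range (2 * M + 1))
    (g := fun m : ℤ => (m - j).natAbs)
    (by intro m hm; rw [Finset.mem_Icc] at hm; rw [Finset.mem_range]; omega)]
  calc _ ≤ ∑ k ∈ Finset.range (2 * M + 1), 2 * ((k + 1 : ℝ))⁻¹ := by
        refine Finset.sum_le_sum fun k _ => ?_
        have hcard : ((Finset.Icc (-(M : ℤ)) M).filter fun m => (m - j).natAbs = k).card ≤ 2 := by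
          refine (Finset.card_le_card (t := {j + k, j - k}) ?_).trans Finset.card_le_two
          intro m hm
          rw [Finset.mem_filter] at hm
          simp only [Finset.mem_insert, Finset.mem_singleton]
          omega
        calc _ ≤ ((Finset.Icc (-(M : ℤ)) M).filter fun m => (m - j).natAbs = k).card •
              ((k + 1 : ℝ))⁻¹ := by
              refine Finset.sum_le_card_nsmul _ _ _ fun m hm => ?_
              rw [(Finset.mem_filter.1 hm).2, add_comm]
          _ ≤ 2 * ((k + 1 : ℝ))⁻¹ := by
              rw [nsmul_eq_mul]
              gcongr
              exact_mod_cast hcard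
    _ = 2 * ((harmonic (2 * M + 1) : ℚ) : ℝ) := by
        rw [← Finset.mul_sum, harmonic]
        push_cast
        rfl
    _ ≤ _ := by
        gcongr
        exact harmonic_le_one_add_log _

lemma sum_Icc_inv_one_add_abs_sub_le (M : ℕ) (s : ℝ) :
    ∑ m ∈ Finset.Icc (-(M : ℤ)) M, (1 + |(m : ℝ) - s|)⁻¹
      ≤ 4 * (1 + Real.log ((2 * M + 1 : ℕ) : ℝ)) := by
  set j : ℤ := max (-(M : ℤ)) (min M ⌊s⌋) with hj
  have hjmem : j ∈ Finset.Icc (-(M : ℤ)) M := by rw [Finset.mem_Icc]; omega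
  calc _ ≤ ∑ m ∈ Finset.Icc (-(M : ℤ)) M, 2 * (1 + ((m - j).natAbs : ℝ))⁻¹ := by
        refine Finset.sum_le_sum fun m hm => ?_
        rw [Finset.mem_Icc] at hm
        have hfl : (m - j).natAbs ≤ (m - ⌊s⌋).natAbs := by omega
        have hfl' : ((m - j).natAbs : ℝ) ≤ |(m : ℝ) - ⌊s⌋| := by
          calc ((m - j).natAbs : ℝ) ≤ ((m - ⌊s⌋).natAbs : ℝ) := by exact_mod_cast hfl
            _ = _ := by rw [Nat.cast_natAbs]; push_cast; rfl
        have h1 : |(m : ℝ) - ⌊s⌋| ≤ |(m : ℝ) - s| + 1 := by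
          have h2 := Int.floor_le s
          have h3 := Int.lt_floor_add_one s
          calc |(m : ℝ) - ⌊s⌋| = |((m : ℝ) - s) + (s - ⌊s⌋)| := by ring_nf
            _ ≤ |(m : ℝ) - s| + |s - ⌊s⌋| := abs_add_le _ _
            _ ≤ _ := by rw [abs_of_nonneg (by linarith : 0 ≤ s - ⌊s⌋)]; linarith
        have h0 := abs_nonneg ((m : ℝ) - s)
        rw [← div_eq_mul_inv, inv_eq_one_div, div_le_div_iff₀ (by positivity) (by positivity)]
        linarith
    _ ≤ _ := by
        rw [← Finset.mul_sum]
        linarith [sum_Icc_inv_one_add_natAbs_sub_le hjmem]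

lemma sum_Icc_inv_one_add_abs_abs_sub_le (M : ℕ) (s : ℝ) :
    ∑ m ∈ Finset.Icc (-(M : ℤ)) M, (1 + |(|(m : ℝ)| - s)|)⁻¹
      ≤ 8 * (1 + Real.log ((2 * M + 1 : ℕ) : ℝ)) := by
  calc _ ≤ ∑ m ∈ Finset.Icc (-(M : ℤ)) M,
        ((1 + |(m : ℝ) - s|)⁻¹ + (1 + |(m : ℝ) - -s|)⁻¹) := by
        refine Finset.sum_le_sum fun m _ => ?_
        have h1 : 0 ≤ (1 + |(m : ℝ) - s|)⁻¹ := by positivity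
        have h2 : 0 ≤ (1 + |(m : ℝ) - -s|)⁻¹ := by positivity
        rcases abs_choice (m : ℝ) with h | h
        · rw [h]
          linarith
        · rw [h, abs_sub_comm, show s - -(m : ℝ) = m - -s by ring]
          linarith
    _ ≤ _ := by
        rw [Finset.sum_add_distrib]
        linarith [sum_Icc_inv_one_add_abs_sub_le M s, sum_Icc_inv_one_add_abs_sub_le M (-s)]

lemma one_add_log_two_mul_floor_le {N : ℝ} (hN : 2 ≤ N) :
    1 + Real.log ((2 * ⌊2 * N⌋₊ + 1 : ℕ) : ℝ) ≤ 6 * Real.log N := by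
  have hfl : (⌊2 * N⌋₊ : ℝ) ≤ 2 * N := Nat.floor_le (by linarith)
  have h2 : Real.log 2 ≤ Real.log N := Real.log_le_log (by norm_num) hN
  have h : Real.log ((2 * ⌊2 * N⌋₊ + 1 : ℕ) : ℝ) ≤ Real.log (2 ^ 3 * N) := by
    refine Real.log_le_log (by positivity) ?_
    push_cast
    linarith
  have hlog : Real.log (2 ^ 3 * N) = 3 * Real.log 2 + Real.log N := by
    rw [Real.log_mul (by norm_num) (by linarith), Real.log_pow]
    norm_num
  linarith [Real.log_two_gt_d9]

/-- Key counting bound in the proof of Theorem 3.1: `mes(B_N(τ,n)) ≤ C log N`. -/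
theorem BN_measure_bound (C₀ : ℝ) (hC₀ : 1 ≤ C₀) :
    ∃ C : ℝ, 0 < C ∧ ∀ N : ℝ, 2 ≤ N → ∀ τ : ℝ, ∀ n : ℤ,
      mes {p : ℝ × ℤ | |τ + p.1 ^ 2 - ((n : ℝ) - (p.2 : ℝ)) ^ 2| ≤ C₀ ∧
            |(p.2 : ℝ)| ≤ 2 * N ∧ |(n : ℝ) - (p.2 : ℝ)| ≤ 2 * N}
        ≤ ENNReal.ofReal (C * Real.log N) := by
  refine ⟨8 * C₀ ^ 2 * 48, by positivity, fun N hN τ n => ?_⟩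
  set M := ⌊2 * N⌋₊
  rw [mes, ← (Equiv.subLeft n).tsum_eq]
  simp only [mem_ofPred_eq, Equiv.subLeft_apply, Int.cast_sub, sub_sub_cancel]
  rw [tsum_eq_sum (s := Finset.Icc (-(M : ℤ)) M)]
  · calc _ ≤ ∑ m ∈ Finset.Icc (-(M : ℤ)) M,
          ENNReal.ofReal (8 * C₀ ^ 2 / (1 + |(|(m : ℝ)| - √τ)|)) := by
          refine Finset.sum_le_sum fun m _ => ?_
          refine le_trans (measure_mono ?_)
            (volume_abs_sq_sub_le_div (A := (m : ℝ) ^ 2 - τ) hC₀ (abs_nonneg _) ?_)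
          · rintro ξ ⟨h, -⟩
            rwa [mem_ofPred_eq, show ξ ^ 2 - ((m : ℝ) ^ 2 - τ) = τ + ξ ^ 2 - (m : ℝ) ^ 2 by ring]
          · rw [sq_abs]
            exact sq_abs_sub_sqrt_le _ _
      _ = ENNReal.ofReal (8 * C₀ ^ 2 *
            ∑ m ∈ Finset.Icc (-(M : ℤ)) M, (1 + |(|(m : ℝ)| - √τ)|)⁻¹) := by
          rw [← ENNReal.ofReal_sum_of_nonneg fun _ _ => by positivity, Finset.mul_sum]
          simp only [div_eq_mul_inv]
      _ ≤ _ := by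
          refine ENNReal.ofReal_le_ofReal ?_
          rw [mul_assoc (8 * C₀ ^ 2)]
          refine mul_le_mul_of_nonneg_left ?_ (by positivity)
          linarith [sum_Icc_inv_one_add_abs_abs_sub_le M (√τ), one_add_log_two_mul_floor_le hN]
  · intro m hm
    convert measure_empty (μ := volume)
    rw [Set.eq_empty_iff_forall_notMem]
    rintro ξ ⟨-, -, h⟩
    refine hm ?_
    have h' : m.natAbs ≤ M := by
      refine Nat.le_floor ?_
      rw [Nat.cast_natAbs]
      push_cast
      exact h
    rw [Finset.mem_Icc]
    omega
end
end

section
/- (Nonresonant level-set bound in the proof of Theorem 1.8) For every constant C₀ ≥ 1 there exists a constant C such that for all N ≥ 2, all τ, ξ ∈ ℝ, and all n ∈ ℤ, mes( A_N(τ,ξ,n) ) ≤ C · log N, where A_N(τ,ξ,n) = { (ξ₁,n₁) ∈ ℝ×ℤ : |τ + ξ₁n₁ + (ξ−ξ₁)(n−n₁)| ≤ C₀, n₁ ≠ n−n₁, |n₁| ≤ 2N, |n−n₁| ≤ 2N, |ξ₁| ≤ 2N, |ξ−ξ₁| ≤ 2N }. -/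
open MeasureTheory Real Set
open scoped ENNReal

noncomputable section

/-- A sublevel set of a nonconstant affine function on `ℝ` has measure at most `2C/|m|`. -/
theorem volume_abs_affine_le (a m C : ℝ) (hm : m ≠ 0) :
    volume {x : ℝ | |a + m * x| ≤ C} ≤ ENNReal.ofReal (2 * (C / |m|)) := by
  rw [← Real.volume_closedBall (-a / m)]
  refine measure_mono fun x hx => ?_
  have hm' : 0 < |m| := abs_pos.mpr hm
  rw [Metric.mem_closedBall, Real.dist_eq, le_div_iff₀ hm', ← abs_mul]
  have h : (x - -a / m) * m = a + m * x := by field_simp; ring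
  rw [h]
  exact hx

/-- The sum of `2C/|m|` over the nonzero integers `|m| ≤ M` is at most `4C (1 + log M)`. -/
theorem tsum_int_inv_abs_le (C : ℝ) (hC : 0 ≤ C) (M : ℕ) :
    ∑' m : ℤ, (if m ≠ 0 ∧ m.natAbs ≤ M then ENNReal.ofReal (2 * (C / |(m : ℝ)|)) else 0)
      ≤ ENNReal.ofReal (4 * C * (1 + Real.log M)) := by
  have half : ∑' j : ℕ, (if j + 1 ≤ M then ENNReal.ofReal (2 * (C / ((j : ℝ) + 1))) else 0)
      ≤ ENNReal.ofReal (2 * C * (1 + Real.log M)) := by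
    rw [tsum_eq_sum (s := Finset.range M) (fun j hj => if_neg (by simpa using hj)),
      Finset.sum_congr rfl (fun j hj => if_pos (by simpa using hj)),
      ← ENNReal.ofReal_sum_of_nonneg (fun j _ => by positivity)]
    refine ENNReal.ofReal_le_ofReal ?_
    have h := harmonic_le_one_add_log M
    rw [harmonic] at h
    push_cast at h
    calc ∑ j ∈ Finset.range M, 2 * (C / ((j : ℝ) + 1))
        = 2 * C * ∑ j ∈ Finset.range M, ((j : ℝ) + 1)⁻¹ := by
          rw [Finset.mul_sum]
          exact Finset.sum_congr rfl fun j _ => by ring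
      _ ≤ _ := by gcongr
  have hlog : 0 ≤ Real.log M := Real.log_natCast_nonneg M
  rw [tsum_of_add_one_of_neg_add_one ENNReal.summable ENNReal.summable]
  calc _ = (∑' j : ℕ, (if j + 1 ≤ M then ENNReal.ofReal (2 * (C / ((j : ℝ) + 1))) else 0))
        + ∑' j : ℕ, (if j + 1 ≤ M then ENNReal.ofReal (2 * (C / ((j : ℝ) + 1))) else 0) := by
        rw [if_neg (by simp), add_zero]
        congr 1 <;> refine tsum_congr fun j => ?_
        · have h1 : ((j : ℤ) + 1 ≠ 0 ∧ ((j : ℤ) + 1).natAbs ≤ M) ↔ j + 1 ≤ M := by omega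
          have h2 : |(((j : ℤ) + 1 : ℤ) : ℝ)| = (j : ℝ) + 1 := by
            push_cast
            exact abs_of_nonneg (by positivity)
          simp only [h1, h2]
        · have h1 : (-((j : ℤ) + 1) ≠ 0 ∧ (-((j : ℤ) + 1)).natAbs ≤ M) ↔ j + 1 ≤ M := by omega
          have h2 : |((-((j : ℤ) + 1) : ℤ) : ℝ)| = (j : ℝ) + 1 := by
            push_cast
            rw [abs_neg]
            exact abs_of_nonneg (by positivity)
          simp only [h1, h2]
    _ ≤ _ := add_le_add half half
    _ = _ := by
        rw [← ENNReal.ofReal_add (by positivity) (by positivity)]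
        congr 1
        ring

/-- Nonresonant level-set bound in the proof of Theorem 1.8: `mes(A_N(τ,ξ,n)) ≤ C log N`. -/
theorem AN_measure_bound (C₀ : ℝ) (hC₀ : 1 ≤ C₀) :
    ∃ C : ℝ, 0 < C ∧ ∀ N : ℝ, 2 ≤ N → ∀ τ ξ : ℝ, ∀ n : ℤ,
      mes {p : ℝ × ℤ | |τ + p.1 * (p.2 : ℝ) + (ξ - p.1) * ((n : ℝ) - (p.2 : ℝ))| ≤ C₀ ∧
            p.2 ≠ n - p.2 ∧
            |(p.2 : ℝ)| ≤ 2 * N ∧ |(n : ℝ) - (p.2 : ℝ)| ≤ 2 * N ∧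
            |p.1| ≤ 2 * N ∧ |ξ - p.1| ≤ 2 * N}
        ≤ ENNReal.ofReal (C * Real.log N) := by
  refine ⟨20 * C₀, by positivity, fun N hN τ ξ n => ?_⟩
  set M : ℕ := ⌊4 * N⌋₊ with hM
  have hlogM : 1 + Real.log M ≤ 5 * Real.log N := by
    have h0 : (M : ℝ) ≤ 4 * N := Nat.floor_le (by positivity)
    have h1 : 0 < M := Nat.floor_pos.mpr (by linarith)
    have h2 : Real.log M ≤ Real.log (4 * N) := Real.log_le_log (by positivity) h0
    have h3 : Real.log (4 * N) = 2 * Real.log 2 + Real.log N := by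
      rw [Real.log_mul (by norm_num) (by positivity), show (4 : ℝ) = 2 ^ 2 by norm_num,
        Real.log_pow]
      norm_num
    have h4 : Real.log 2 ≤ Real.log N := Real.log_le_log (by norm_num) hN
    linarith [Real.log_two_gt_d9]
  have hinj : Function.Injective fun k : ℤ => 2 * k - n := fun a b h => by
    simp only at h
    omega
  refine le_trans ?_ ((ENNReal.tsum_comp_le_tsum_of_injective hinj
    (fun m : ℤ => if m ≠ 0 ∧ m.natAbs ≤ M then
      ENNReal.ofReal (2 * (C₀ / |(m : ℝ)|)) else 0)).trans
    ((tsum_int_inv_abs_le C₀ (by positivity) M).trans (ENNReal.ofReal_le_ofReal ?_)))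
  · refine ENNReal.tsum_le_tsum fun k => ?_
    split_ifs with hk
    · refine le_trans (measure_mono fun x hx => ?_) (volume_abs_affine_le
        (τ + ξ * ((n : ℝ) - k)) ((2 * k - n : ℤ) : ℝ) C₀ (by exact_mod_cast hk.1))
      have h := hx.1
      rw [mem_ofPred_eq]
      convert h using 2
      push_cast
      ring
    · refine le_of_eq ?_
      convert measure_empty (μ := (volume : Measure ℝ)) using 2
      refine eq_empty_of_forall_notMem fun x hx => hk ?_
      obtain ⟨-, hne, hk1, hk2, -, -⟩ := hx
      refine ⟨by dsimp only at hne; omega, Nat.le_floor ?_⟩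
      rw [Nat.cast_natAbs, Int.cast_abs]
      push_cast
      dsimp only at hk1 hk2
      rw [abs_le] at hk1 hk2 ⊢
      constructor <;> linarith
  · nlinarith
end
end
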